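/- If F ⊂ E is closed as a subset of X, then cap_p(F, E) = cap_p(∂F, E), where ∂F denotes the boundary of F in X. -/

import Mathlib

open MeasureTheory Metric Set Filter
open scoped ENNReal NNReal Topology

noncomputable section

variable {X : Type*} [MetricSpace X] [MeasurableSpace X] [BorelSpace X]

/-- A nonconstant, compact, rectifiable curve in `X`, parameterized by arc length on
`[0, len]`. The arc-length parameterization is expressed by requiring that the length
(total variation) of the curve on each subinterval `[s, t]` equals `t - s`. -/
structure Curve (X : Type*) [MetricSpace X] where
  len : ℝ
  len_pos : 0 < len
  toFun : ℝ → X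
  continuousOn : ContinuousOn toFun (Set.Icc 0 len)
  arclength : ∀ s t : ℝ, s ∈ Set.Icc 0 len → t ∈ Set.Icc 0 len → s ≤ t →
    eVariationOn toFun (Set.Icc s t) = ENNReal.ofReal (t - s)
  nonconstant : ∃ s ∈ Set.Icc 0 len, ∃ t ∈ Set.Icc 0 len, toFun s ≠ toFun t

/-- The curve integral `∫_γ g ds` of a nonnegative function along an arc-length
parameterized curve. -/
def Curve.integral (γ : Curve X) (g : X → ℝ≥0∞) : ℝ≥0∞ :=
  ∫⁻ t in Set.Icc (0 : ℝ) γ.len, g (γ.toFun t)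

/-- `|a - b|` with the convention that it is `∞` whenever both `a` and `b` are infinite. -/
def ugDiff (a b : EReal) : ℝ≥0∞ :=
  if a.abs = ⊤ ∨ b.abs = ⊤ then ⊤ else (a - b).abs

/-- The upper gradient inequality for `f` and `g` along the curve `γ`. -/
def UGOn (f : X → EReal) (g : X → ℝ≥0∞) (γ : Curve X) : Prop :=
  ugDiff (f (γ.toFun 0)) (f (γ.toFun γ.len)) ≤ γ.integral g

/-- A curve family has zero `p`-modulus. -/
def ZeroModulus (p : ℝ) (μ : Measure X) (Γ : Set (Curve X)) : Prop :=
  ∃ ρ : X → ℝ≥0∞, Measurable ρ ∧ (∫⁻ x, ρ x ^ p ∂μ) < ⊤ ∧ ∀ γ ∈ Γ, γ.integral ρ = ⊤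

/-- `g` is an upper gradient of `f`. -/
def IsUpperGradient (f : X → EReal) (g : X → ℝ≥0∞) : Prop :=
  Measurable g ∧ ∀ γ : Curve X, UGOn f g γ

/-- `g` is a `p`-weak upper gradient of `f`: the upper gradient inequality holds for
`p`-almost every curve. -/
def IsWeakUpperGradient (p : ℝ) (μ : Measure X) (f : X → EReal) (g : X → ℝ≥0∞) : Prop :=
  Measurable g ∧ ZeroModulus p μ {γ : Curve X | ¬ UGOn f g γ}

/-- The energy `∫_X g_u^p dμ` of the minimal `p`-weak upper gradient of `u`, expressed as
the infimum of `∫_X g^p dμ` over all `p`-weak upper gradients `g` of `u`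
(`= ∞` if `u` has no `p`-weak upper gradient). -/
def gradEnergy (p : ℝ) (μ : Measure X) (u : X → EReal) : ℝ≥0∞ :=
  ⨅ (g : X → ℝ≥0∞) (_ : IsWeakUpperGradient p μ u g), ∫⁻ x, g x ^ p ∂μ

/-- The Newtonian energy `‖u‖_{N^{1,p}(X)}^p = ∫_X |u|^p dμ + ∫_X g_u^p dμ`. -/
def newtonianEnergy (p : ℝ) (μ : Measure X) (u : X → EReal) : ℝ≥0∞ :=
  (∫⁻ x, (u x).abs ^ p ∂μ) + gradEnergy p μ u

/-- Membership in the Newtonian space `N^{1,p}(X)` (measurability is with respect to the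
completion of the Borel σ-algebra, i.e. a.e.-measurability). -/
def MemNewtonian (p : ℝ) (μ : Measure X) (u : X → EReal) : Prop :=
  AEMeasurable u μ ∧ newtonianEnergy p μ u < ⊤

/-- Membership in `N^{1,p}_0(E)`, members being regarded as functions on all of `X`
that vanish outside `E`. -/
def MemNewtonian0 (p : ℝ) (μ : Measure X) (E : Set X) (u : X → EReal) : Prop :=
  MemNewtonian p μ u ∧ ∀ x ∉ E, u x = 0

/-- The Sobolev capacity `C_p(A)`. -/
def sobolevCapacity (p : ℝ) (μ : Measure X) (A : Set X) : ℝ≥0∞ :=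
  ⨅ (u : X → EReal) (_ : MemNewtonian p μ u ∧ ∀ x ∈ A, u x = 1), newtonianEnergy p μ u

/-- The variational capacity `cap_p(A, E)`. -/
def varCapacity (p : ℝ) (μ : Measure X) (A E : Set X) : ℝ≥0∞ :=
  ⨅ (u : X → EReal) (_ : MemNewtonian0 p μ E u ∧ ∀ x ∈ A, 1 ≤ u x), gradEnergy p μ u

/-- A function is quasicontinuous if outside open sets of arbitrarily small Sobolev
capacity it is real-valued and continuous. -/
def QuasicontinuousFun (p : ℝ) (μ : Measure X) (u : X → EReal) : Prop :=
  ∀ ε : ℝ≥0∞, 0 < ε → ∃ G : Set X, IsOpen G ∧ sobolevCapacity p μ G < ε ∧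
    (∀ x ∈ Gᶜ, u x ≠ ⊤ ∧ u x ≠ ⊥) ∧ ContinuousOn u Gᶜ

/-- The capacity `~cap_p(A,E)`: the infimum of `cap_p(G,E)` over all relatively open
subsets `G` of `E` containing `A`. -/
def varCapacityT (p : ℝ) (μ : Measure X) (A E : Set X) : ℝ≥0∞ :=
  ⨅ (G : Set X) (_ : A ⊆ G ∧ G ⊆ E ∧ ∃ U : Set X, IsOpen U ∧ G = U ∩ E),
    varCapacity p μ G E


/-- The subcurve of `γ` corresponding to the parameter interval `[a, b]`. -/
def Curve.subcurve {X : Type*} [MetricSpace X] (γ : Curve X) (a b : ℝ) (ha : 0 ≤ a) (hab : a < b)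
    (hb : b ≤ γ.len) : Curve X where
  len := b - a
  len_pos := sub_pos.2 hab
  toFun t := γ.toFun (a + t)
  continuousOn := γ.continuousOn.comp (by fun_prop)
    fun t ht => ⟨by linarith [ht.1], by linarith [ht.2]⟩
  arclength s t hs ht hst := by
    have h := eVariationOn.comp_eq_of_monotoneOn γ.toFun (t := Set.Icc s t) (fun t => a + t)
      (fun _ _ _ _ h => by simpa using h)
    rw [Set.image_const_add_Icc] at h
    refine h.trans ?_
    rw [γ.arclength (a + s) (a + t) ⟨by linarith [hs.1], by linarith [hs.2]⟩
      ⟨by linarith [ht.1], by linarith [ht.2]⟩ (by linarith)]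
    congr 1
    ring
  nonconstant := by
    by_contra! hcon
    have h := γ.arclength a b ⟨ha, by linarith⟩ ⟨by linarith, hb⟩ hab.le
    have h0 : eVariationOn γ.toFun (Set.Icc a b) = 0 := by
      rw [eVariationOn.eq_zero_iff]
      intro x hx y hy
      have := hcon (x - a) ⟨by linarith [hx.1], by linarith [hx.2]⟩
        (y - a) ⟨by linarith [hy.1], by linarith [hy.2]⟩
      simp only [add_sub_cancel] at this
      simp [this]
    rw [h0] at h
    exact (ENNReal.ofReal_pos.2 (sub_pos.2 hab)).ne h

theorem Curve.integral_subcurve_le {X : Type*} [MetricSpace X] (γ : Curve X) (a b : ℝ)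
    (ha : 0 ≤ a) (hab : a < b) (hb : b ≤ γ.len) (g : X → ℝ≥0∞) :
    (γ.subcurve a b ha hab hb).integral g ≤ γ.integral g := by
  have h : (γ.subcurve a b ha hab hb).integral g
      = ∫⁻ t in Set.Icc a b, g (γ.toFun t) := by
    rw [Curve.integral, ← lintegral_indicator measurableSet_Icc,
      ← lintegral_indicator measurableSet_Icc,
      ← lintegral_add_left_eq_self (μ := volume)
        ((Set.Icc a b).indicator fun t => g (γ.toFun t)) a]
    congr 1
    ext t
    have : t ∈ Set.Icc 0 (b - a) ↔ a + t ∈ Set.Icc a b := by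
      simp only [Set.mem_Icc]
      constructor <;> rintro ⟨h1, h2⟩ <;> constructor <;> linarith
    by_cases ht : t ∈ Set.Icc 0 (b - a)
    · rw [Set.indicator_of_mem (this.1 ht)]
      exact Set.indicator_of_mem ht _
    · rw [Set.indicator_of_notMem (mt this.2 ht)]
      exact Set.indicator_of_notMem ht _
  rw [h]
  exact lintegral_mono_set (Set.Icc_subset_Icc ha hb)

theorem ugDiff_comm (a b : EReal) : ugDiff a b = ugDiff b a := by
  simp only [ugDiff, or_comm (a := a.abs = ⊤)]
  split_ifs with h
  · rfl
  · push Not at h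
    induction a <;> induction b <;> simp_all
    rw [← EReal.coe_sub, ← EReal.coe_sub, EReal.abs_def, EReal.abs_def, abs_sub_comm]

/-- Truncation of an extended real number to `[0, 1]`. -/
def truncUnit (a : EReal) : EReal := max 0 (min a 1)

theorem truncUnit_of_one_le {a : EReal} (h : 1 ≤ a) : truncUnit a = 1 := by
  simp [truncUnit, h]

theorem truncUnit_coe (a : ℝ) : truncUnit a = ((max 0 (min a 1) : ℝ) : EReal) := by
  rw [truncUnit, EReal.coe_strictMono.monotone.map_max, EReal.coe_strictMono.monotone.map_min,
    EReal.coe_zero, EReal.coe_one]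

theorem abs_truncUnit_le (a : EReal) : (truncUnit a).abs ≤ a.abs := by
  induction a with
  | bot => simp
  | top => simp
  | coe a =>
    rw [truncUnit_coe, EReal.abs_def, EReal.abs_def]
    apply ENNReal.ofReal_le_ofReal
    grind

theorem ugDiff_truncUnit_le (a b : EReal) :
    ugDiff (truncUnit a) (truncUnit b) ≤ ugDiff a b := by
  by_cases h : a.abs = ⊤ ∨ b.abs = ⊤
  · simp [ugDiff, h]
  · push Not at h
    induction a <;> induction b <;> simp_all
    rename_i a b
    simp only [truncUnit_coe, ugDiff, EReal.abs_def, ENNReal.ofReal_ne_top, or_self, if_false, ← EReal.coe_sub]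
    apply ENNReal.ofReal_le_ofReal
    grind

open Classical in
/-- The truncation of `u` to `[0, 1]`, redefined to be `1` on `F`. -/
def fillIn {X : Type*} (F : Set X) (u : X → EReal) (x : X) : EReal :=
  if x ∈ F then 1 else truncUnit (u x)

theorem fillIn_of_mem {X : Type*} {F : Set X} {x : X} (u : X → EReal) (h : x ∈ F) :
    fillIn F u x = 1 := if_pos h

theorem fillIn_of_notMem {X : Type*} {F : Set X} {x : X} (u : X → EReal) (h : x ∉ F) :
    fillIn F u x = truncUnit (u x) := if_neg h

theorem exists_mem_frontier_of_curve {X : Type*} [MetricSpace X] (γ : Curve X) {F : Set X}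
    (h₁ : ∃ s ∈ Set.Icc 0 γ.len, γ.toFun s ∈ F) (h₂ : ∃ s ∈ Set.Icc 0 γ.len, γ.toFun s ∉ F) :
    ∃ t ∈ Set.Icc 0 γ.len, γ.toFun t ∈ frontier F := by
  have hc : IsPreconnected (γ.toFun '' Set.Icc 0 γ.len) :=
    isPreconnected_Icc.image _ γ.continuousOn
  obtain ⟨s, hs, hsF⟩ := h₁
  obtain ⟨r, hr, hrF⟩ := h₂
  by_contra! hcon
  have hint : ∀ t ∈ Set.Icc 0 γ.len, γ.toFun t ∈ closure F → γ.toFun t ∈ interior F := by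
    intro t ht h
    by_contra h'
    exact hcon t ht ⟨h, h'⟩
  obtain ⟨x, -, hxi, hxc⟩ := hc (interior F) (closure F)ᶜ isOpen_interior
    isClosed_closure.isOpen_compl
    (by
      rintro _ ⟨t, ht, rfl⟩
      exact (em (γ.toFun t ∈ closure F)).imp_left (hint t ht))
    ⟨_, ⟨s, hs, rfl⟩, hint s hs (subset_closure hsF)⟩
    ⟨_, ⟨r, hr, rfl⟩, fun h => hrF (interior_subset (hint r hr h))⟩
  exact hxc (subset_closure (interior_subset hxi))

/-- If the upper gradient inequality for `u` holds on all subcurves of `γ`, and `u ≥ 1` on the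
boundary of the closed set `F`, then it holds on `γ` for `fillIn F u`. -/
theorem UGOn.fillIn {X : Type*} [MetricSpace X] {F : Set X} (hF : IsClosed F) {u : X → EReal}
    (hu : ∀ x ∈ frontier F, 1 ≤ u x) {g : X → ℝ≥0∞} {γ : Curve X}
    (h : ∀ a b ha hab hb, UGOn u g (γ.subcurve a b ha hab hb)) : UGOn (fillIn F u) g γ := by
  have key : ∀ a b, 0 ≤ a → a < b → b ≤ γ.len →
      ugDiff (truncUnit (u (γ.toFun a))) (truncUnit (u (γ.toFun b))) ≤ γ.integral g := by
    intro a b ha hab hb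
    have h' := (h a b ha hab hb).trans (γ.integral_subcurve_le a b ha hab hb g)
    simp only [Curve.subcurve, add_zero, add_sub_cancel] at h'
    exact (ugDiff_truncUnit_le _ _).trans h'
  have h0 : (0 : ℝ) ∈ Set.Icc 0 γ.len := ⟨le_rfl, γ.len_pos.le⟩
  have h1 : γ.len ∈ Set.Icc 0 γ.len := ⟨γ.len_pos.le, le_rfl⟩
  rw [UGOn]
  by_cases hx : γ.toFun 0 ∈ F <;> by_cases hy : γ.toFun γ.len ∈ F
  · rw [fillIn_of_mem u hx, fillIn_of_mem u hy]
    have : (1 : EReal) - 1 = 0 := by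
      rw [← EReal.coe_one, ← EReal.coe_sub, sub_self, EReal.coe_zero]
    have h1 : (1 : EReal).abs ≠ ⊤ := by
      rw [← EReal.coe_one, EReal.abs_def]
      exact ENNReal.ofReal_ne_top
    simp [ugDiff, this, h1]
  · obtain ⟨t, ht, htF⟩ := exists_mem_frontier_of_curve γ ⟨0, h0, hx⟩ ⟨_, h1, hy⟩
    rw [fillIn_of_mem u hx, fillIn_of_notMem u hy, ← truncUnit_of_one_le (hu _ htF)]
    refine key _ _ ht.1 (lt_of_le_of_ne ht.2 ?_) le_rfl
    rintro rfl
    exact hy (hF.frontier_subset htF)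
  · obtain ⟨t, ht, htF⟩ := exists_mem_frontier_of_curve γ ⟨_, h1, hy⟩ ⟨0, h0, hx⟩
    rw [fillIn_of_mem u hy, fillIn_of_notMem u hx, ← truncUnit_of_one_le (hu _ htF)]
    refine key _ _ le_rfl (lt_of_le_of_ne ht.1 ?_) ht.2
    rintro rfl
    exact hx (hF.frontier_subset htF)
  · rw [fillIn_of_notMem u hx, fillIn_of_notMem u hy]
    exact key _ _ le_rfl γ.len_pos le_rfl

theorem IsWeakUpperGradient.fillIn {X : Type*} [MetricSpace X] [MeasurableSpace X]
    {p : ℝ} {μ : Measure X} {F : Set X} (hF : IsClosed F) {u : X → EReal}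
    (hu : ∀ x ∈ frontier F, 1 ≤ u x) {g : X → ℝ≥0∞} (hg : IsWeakUpperGradient p μ u g) :
    IsWeakUpperGradient p μ (fillIn F u) g := by
  obtain ⟨hm, ρ, hρ, hρp, hρΓ⟩ := hg
  refine ⟨hm, ρ, hρ, hρp, fun γ hγ => ?_⟩
  contrapose! hγ
  simp only [Set.mem_ofPred_eq, not_not]
  refine UGOn.fillIn hF hu fun a b ha hab hb => ?_
  by_contra hcon
  exact hγ (top_le_iff.1 ((hρΓ _ hcon).ge.trans (γ.integral_subcurve_le a b ha hab hb ρ)))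

theorem gradEnergy_fillIn_le {X : Type*} [MetricSpace X] [MeasurableSpace X]
    {p : ℝ} {μ : Measure X} {F : Set X} (hF : IsClosed F) {u : X → EReal}
    (hu : ∀ x ∈ frontier F, 1 ≤ u x) : gradEnergy p μ (fillIn F u) ≤ gradEnergy p μ u :=
  le_iInf₂ fun g hg => iInf₂_le g (hg.fillIn hF hu)

theorem MemNewtonian.fillIn {X : Type*} [MetricSpace X] [MeasurableSpace X] [BorelSpace X]
    {p : ℝ} (hp : 0 ≤ p) {μ : Measure X} {F : Set X} (hF : IsClosed F) (hμF : μ F < ⊤)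
    {u : X → EReal} (hu : ∀ x ∈ frontier F, 1 ≤ u x) (hmem : MemNewtonian p μ u) :
    MemNewtonian p μ (fillIn F u) := by
  classical
  obtain ⟨hm, he⟩ := hmem
  rw [newtonianEnergy, ENNReal.add_lt_top] at he
  have htr : AEMeasurable (fun x => truncUnit (u x)) μ :=
    aemeasurable_const.max (hm.min aemeasurable_const)
  refine ⟨?_, ENNReal.add_lt_top.2 ⟨?_, (gradEnergy_fillIn_le hF hu).trans_lt he.2⟩⟩
  · refine ⟨F.piecewise (fun _ => 1) (htr.mk _),
      measurable_const.piecewise hF.measurableSet htr.measurable_mk, ?_⟩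
    filter_upwards [htr.ae_eq_mk] with x hx
    by_cases h : x ∈ F
    · simp [fillIn_of_mem u h, h]
    · simp [fillIn_of_notMem u h, h, hx]
  · calc ∫⁻ x, (_root_.fillIn F u x).abs ^ p ∂μ
        ≤ ∫⁻ x, F.indicator 1 x + (u x).abs ^ p ∂μ := by
          refine lintegral_mono fun x => ?_
          by_cases hx : x ∈ F
          · have h1 : (1 : EReal).abs = 1 := by
              rw [← EReal.coe_one, EReal.abs_def]
              simp
            simp [fillIn_of_mem u hx, hx, h1]
          · rw [fillIn_of_notMem u hx, Set.indicator_of_notMem hx, zero_add]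
            exact ENNReal.rpow_le_rpow (abs_truncUnit_le _) hp
      _ = μ F + ∫⁻ x, (u x).abs ^ p ∂μ := by
          rw [lintegral_add_left (measurable_one.indicator hF.measurableSet),
            lintegral_indicator_one hF.measurableSet]
      _ < ⊤ := ENNReal.add_lt_top.2 ⟨hμF, he.1⟩

theorem varCapacity_mono {X : Type*} [MetricSpace X] [MeasurableSpace X] (p : ℝ) (μ : Measure X)
    {A B : Set X} (E : Set X) (h : A ⊆ B) : varCapacity p μ A E ≤ varCapacity p μ B E :=
  le_iInf₂ fun u hu => iInf₂_le u ⟨hu.1, fun x hx => hu.2 x (h hx)⟩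

/-- If `F ⊆ E` is closed in `X`, then `cap_p(F,E) = cap_p(∂F,E)`. -/
theorem stmt_8 (p : ℝ) (hp : 1 ≤ p) (μ : Measure X)
    (hball : ∀ (x : X) (r : ℝ), 0 < r → 0 < μ (Metric.ball x r) ∧ μ (Metric.ball x r) < ⊤)
    (E : Set X) (hE : Bornology.IsBounded E)
    (F : Set X) (hF : IsClosed F) (hFE : F ⊆ E) :
    varCapacity p μ F E = varCapacity p μ (frontier F) E := by
  refine le_antisymm (le_iInf₂ fun u hu => ?_) (varCapacity_mono p μ E hF.frontier_subset)
  obtain ⟨⟨hmem, hzero⟩, hone⟩ := hu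
  have hμF : μ F < ⊤ := by
    rcases F.eq_empty_or_nonempty with rfl | ⟨x, -⟩
    · simp
    · obtain ⟨r, hr, hEr⟩ := hE.subset_ball_lt 0 x
      exact (measure_mono (hFE.trans hEr)).trans_lt (hball x r hr).2
  refine (iInf₂_le (fillIn F u) ⟨⟨hmem.fillIn (by linarith) hF hμF hone, fun x hx => ?_⟩,
    fun x hx => (fillIn_of_mem u hx).ge⟩).trans (gradEnergy_fillIn_le hF hone)
  rw [fillIn_of_notMem u fun h => hx (hFE h), hzero x hx]
  simp [truncUnit]

end
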